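/- In every execution of Algorithm A_k, if a process i decides an output y with y ∈ {0,1}, then its input satisfies x_i = y. -/

import Mathlib

/-!
Operational semantics of the two-process 1-bit-register approximate-agreement
protocol `A_k` (Algorithm 1 of the paper).

The two processes are indexed by `Fin 2`.  Shared memory consists of two 1-bit
registers `R 0, R 1` (initialized to `false`, i.e. `0`; only process `i` writes
`R i`) and two write-once input registers `I 0, I 1` (initialized to `⊥ = none`).
Each read or write of a single register is one atomic step.  An execution is
determined by the inputs `x : Fin 2 → Bool` together with a schedule
`sched : ℕ → Fin 2` telling which process takes the next step (a step of a
process that has already decided is a no-op; a process crashes by being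
scheduled only finitely often).
-/

namespace AlgoAk

/-- The other process. -/
def other (i : Fin 2) : Fin 2 := if i = 0 then 1 else 0

/-- The value (0 or 1) as a rational. -/
def bq (b : Bool) : ℚ := if b then 1 else 0

/-- Program counter of a process:
`start` = about to write its input to its input register;
`loopW` = about to perform the write of the current for-loop iteration;
`loopR` = about to perform the read of the current for-loop iteration;
`readMine` = left the for-loop, about to read its own input register;
`readOther` = about to read the other input register (and then decide);
`done` = has decided. -/
inductive PC where
  | start | loopW | loopR | readMine | readOther | done
deriving DecidableEq

/-- Local state of a process: program counter, loop variable `r`, local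
variables `prec` and `new`, the value read from the other input register,
and the output (once decided). -/
structure PState where
  pc : PC
  r : ℕ
  prec : Bool
  new : Bool
  xother : Option Bool
  out : Option ℚ

/-- Global configuration: local states, the two 1-bit registers, and the two
write-once input registers. -/
structure Config where
  p : Fin 2 → PState
  R : Fin 2 → Bool
  I : Fin 2 → Option Bool

/-- Initial local state. -/
def initP : PState := ⟨PC.start, 1, false, false, none, none⟩

/-- Initial configuration. -/
def initC : Config := ⟨fun _ => initP, fun _ => false, fun _ => none⟩

/-- Update the local state of process `i`. -/
def updP (c : Config) (i : Fin 2) (s : PState) : Config :=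
  { c with p := Function.update c.p i s }

/-- The decision function of the protocol, computed from the process' own input
`xme`, the value `xother` read from the other input register, and the values
`r` and `new` of the local variables when the for-loop was left. -/
def decideVal (k : ℕ) (xme : Bool) (xother : Option Bool) (r : ℕ) (new : Bool) : ℚ :=
  match xother with
  | none => bq xme
  | some xo =>
    if xme = xo then bq xme
    else if r = k ∧ new = decide (k % 2 = 1) then
      -- normal termination after k iterations
      let xwho := if r % 2 = 0 then xme else xo
      (bq xwho + (k : ℚ)) / (2 * (k : ℚ) + 1)
    else
      -- left the loop via a break at iteration r
      let xwho := if r % 2 = 0 then xo else xme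
      bq xwho + ((-1 : ℚ) ^ (if xwho then 1 else 0) * ((r : ℚ) - 1)) / (2 * (k : ℚ) + 1)

/-- One atomic step of process `i` in configuration `c`. -/
def step (k : ℕ) (x : Fin 2 → Bool) (c : Config) (i : Fin 2) : Config :=
  let s := c.p i
  match s.pc with
  | PC.start =>
      let c' := updP c i { s with pc := PC.loopW }
      { c' with I := Function.update c'.I i (some (x i)) }
  | PC.loopW =>
      let c' := updP c i { s with pc := PC.loopR }
      { c' with R := Function.update c'.R i (decide (s.r % 2 = 1)) }
  | PC.loopR =>
      let nv := c.R (other i)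
      if nv ≠ s.prec then
        if s.r < k then
          updP c i { s with pc := PC.loopW, r := s.r + 1, prec := nv, new := nv }
        else
          updP c i { s with pc := PC.readMine, prec := nv, new := nv }
      else
        updP c i { s with pc := PC.readMine, new := nv }
  | PC.readMine =>
      updP c i { s with pc := PC.readOther }
  | PC.readOther =>
      let xo := c.I (other i)
      updP c i { s with pc := PC.done, xother := xo,
                        out := some (decideVal k (x i) xo s.r s.new) }
  | PC.done => c

/-- The configuration after `n` steps of the execution of `A_k` with inputs `x`
and schedule `sched`. -/
def run (k : ℕ) (x : Fin 2 → Bool) (sched : ℕ → Fin 2) : ℕ → Config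
  | 0 => initC
  | n + 1 => step k x (run k x sched n) (sched n)

/-- With a loop variable in the range `1, …, k`, the decision function takes no value in `{0, 1}`
other than the process' own input. -/
theorem decideVal_eq_bq {k : ℕ} {xme : Bool} {xo : Option Bool} {r : ℕ} {new : Bool}
    (hr : 1 ≤ r) (hrk : r ≤ k)
    (h : decideVal k xme xo r new = 0 ∨ decideVal k xme xo r new = 1) :
    decideVal k xme xo r new = bq xme := by
  have hr' : (1 : ℚ) ≤ r := by exact_mod_cast hr
  have hrk' : (r : ℚ) ≤ k := by exact_mod_cast hrk
  have hpos : (0 : ℚ) < 2 * k + 1 := by positivity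
  rcases xo with _ | xo
  · rfl
  by_cases hx : xme = xo
  · simp [decideVal, hx]
  by_cases hn : r = k ∧ new = decide (k % 2 = 1)
  · exfalso
    simp only [decideVal, hx, hn, if_false, and_self, if_true] at h
    rw [div_eq_zero_iff, div_eq_one_iff_eq hpos.ne'] at h
    generalize (if k % 2 = 0 then xme else xo) = who at h
    cases who <;> simp only [bq] at h <;> rcases h with (h | h) | h <;> norm_num at h <;> linarith
  simp only [decideVal, hx, hn, if_false] at h ⊢
  obtain rfl | hr2 : r = 1 ∨ 2 ≤ r := by omega
  · simp
  exfalso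
  have hr2' : (2 : ℚ) ≤ r := by exact_mod_cast hr2
  have hlo : (0 : ℚ) < (r - 1) / (2 * k + 1) := div_pos (by linarith) hpos
  have hhi : ((r : ℚ) - 1) / (2 * k + 1) < 1 := (div_lt_one hpos).2 (by linarith)
  generalize (if r % 2 = 0 then xo else xme) = who at h
  rw [mul_div_assoc] at h
  generalize ((r : ℚ) - 1) / (2 * k + 1) = q at h hlo hhi
  cases who <;> simp only [bq] at h <;> rcases h with h | h <;> norm_num at h <;> linarith

/-- The loop variable stays in the range `1, …, k`, and binary outputs equal the input. -/
theorem run_invariant {k : ℕ} (hk : 1 ≤ k) (x : Fin 2 → Bool) (sched : ℕ → Fin 2) (n : ℕ)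
    (i : Fin 2) :
    (1 ≤ ((run k x sched n).p i).r ∧ ((run k x sched n).p i).r ≤ k) ∧
      ∀ y, ((run k x sched n).p i).out = some y → y = 0 ∨ y = 1 → y = bq (x i) := by
  induction n generalizing i with
  | zero => simp [run, initC, initP, hk]
  | succ n ih =>
    rw [run]
    generalize run k x sched n = c at ih
    generalize sched n = j
    by_cases hij : i = j
    · subst hij
      obtain ⟨⟨h1, h2⟩, h3⟩ := ih i
      unfold step
      dsimp only
      split
      case h_5 =>
        simp only [updP, Function.update_self, Option.some.injEq]
        refine ⟨⟨h1, h2⟩, ?_⟩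
        rintro y rfl hy
        exact decideVal_eq_bq h1 h2 hy
      all_goals
        first
        | exact ⟨⟨h1, h2⟩, h3⟩
        | (try split_ifs) <;> simp only [updP, Function.update_self] <;>
            exact ⟨⟨by omega, by omega⟩, h3⟩
    · have hp : (step k x c j).p i = c.p i := by
        unfold step
        dsimp only
        split <;> (try split_ifs) <;> simp [updP, Function.update_of_ne hij]
      rw [hp]
      exact ih i

end AlgoAk

open AlgoAk in
/-- Lemma 11: in any execution of `A_k`, if a process decides an output
`y ∈ {0, 1}`, then its input is `y`. -/
theorem binary_output_equals_input (k : ℕ) (hk : 1 ≤ k) (x : Fin 2 → Bool)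
    (sched : ℕ → Fin 2) (n : ℕ) (i : Fin 2) (y : ℚ)
    (hdec : ((run k x sched n).p i).out = some y)
    (hy : y = 0 ∨ y = 1) :
    y = bq (x i) := by
  exact (run_invariant hk x sched n i).2 y hdec hy
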